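/- In the dense regime, the covariance rank (Spearman) test achieves the detection boundary in the Gaussian mixture copula model: let F and G be strictly increasing continuous distribution functions on ℝ, and suppose the observations are (X_i, Y_i) = (F^{-1}(Φ(Z¹_i)), G^{-1}(Φ(Z²_i))) for i = 1,…,n, where (Z¹_i, Z²_i) are i.i.d. from P_{ε_n,ρ_n}. Let R_i be the rank of X_i among X₁,…,Xₙ and S_i the rank of Y_i among Y₁,…,Yₙ (ranks in {1,…,n}), and T_n := Σ_{i=1}^n R_i S_i. If ε_n = n^{-β} and ρ_n = n^{-γ} with β, γ > 0 fixed such that γ < 1/2 − β, then the sequence of tests rejecting when T_n ≥ n(n+1)²/4 + n^{5/2} log n is asymptotically powerful (its type I error probability, computed when X₁,…,Xₙ,Y₁,…,Yₙ are all mutually independent with continuous marginals, and its type II error probability both tend to 0). -/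

import Mathlib

open MeasureTheory ProbabilityTheory Real Filter Topology

noncomputable section

/-- The standard normal distribution on ℝ. -/
def stdGauss : Measure ℝ := gaussianReal 0 1

/-- Two independent standard normals. -/
def stdGauss2 : Measure (ℝ × ℝ) := stdGauss.prod stdGauss

/-- `N(0, Σ_ρ)`: the centered bivariate normal with unit marginal variances and
correlation `ρ`, i.e. the law of `(Z₁, ρ Z₁ + √(1-ρ²) Z₂)` for independent standard
normal `Z₁, Z₂`. -/
def biNormal (ρ : ℝ) : Measure (ℝ × ℝ) :=
  stdGauss2.map fun z => (z.1, ρ * z.1 + Real.sqrt (1 - ρ ^ 2) * z.2)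

/-- The contamination mixture `P_{ε,ρ} = (1-ε) N(0,Σ₀) + ε N(0,Σ_ρ)`. -/
def mixture (ε ρ : ℝ) : Measure (ℝ × ℝ) :=
  ENNReal.ofReal (1 - ε) • biNormal 0 + ENNReal.ofReal ε • biNormal ρ

/-- The `n`-fold product (i.i.d.) measure. -/
def iid (n : ℕ) (μ : Measure (ℝ × ℝ)) : Measure (Fin n → ℝ × ℝ) :=
  Measure.pi fun _ => μ
/-- The standard normal distribution function. -/
def Phi (t : ℝ) : ℝ := (stdGauss (Set.Iic t)).toReal

/-- The rank (in `{1, …, n}`) of the `i`-th entry of `x` among `x 1, …, x n`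
(assuming no ties). -/
def rankOf (n : ℕ) (x : Fin n → ℝ) (i : Fin n) : ℕ :=
  (Finset.univ.filter fun j => x j ≤ x i).card

/-- The observation map of the Gaussian mixture copula model: the latent vector
`z = ((Z¹₁,Z²₁),…,(Z¹ₙ,Z²ₙ))` is observed as `(Xᵢ, Yᵢ) = (F⁻¹(Φ(Z¹ᵢ)), G⁻¹(Φ(Z²ᵢ)))`. -/
def obsMap (F G : ℝ → ℝ) (n : ℕ) (z : Fin n → ℝ × ℝ) : Fin n → ℝ × ℝ :=
  fun i => (Function.invFun F (Phi (z i).1), Function.invFun G (Phi (z i).2))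

/-- The Spearman covariance rank statistic `Tₙ = Σᵢ Rᵢ Sᵢ`. -/
def spearmanT (n : ℕ) (x : Fin n → ℝ × ℝ) : ℝ :=
  ∑ i, (rankOf n (fun j => (x j).1) i : ℝ) * (rankOf n (fun j => (x j).2) i : ℝ)

open scoped Classical in
/-- The indicator that the entries `i, j, k` of `z` satisfy `X j ≤ X i` and `Y k ≤ Y i`, where
`t = (i, j, k)`. -/
def tripleInd {n : ℕ} (t : Fin n × Fin n × Fin n) (z : Fin n → ℝ × ℝ) : ℝ :=
  if (z t.2.1).1 ≤ (z t.1).1 ∧ (z t.2.2).2 ≤ (z t.1).2 then 1 else 0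

lemma tripleInd_nonneg {n : ℕ} (t : Fin n × Fin n × Fin n) (z : Fin n → ℝ × ℝ) :
    0 ≤ tripleInd t z := by
  unfold tripleInd; split_ifs <;> norm_num

lemma tripleInd_le_one {n : ℕ} (t : Fin n × Fin n × Fin n) (z : Fin n → ℝ × ℝ) :
    tripleInd t z ≤ 1 := by
  unfold tripleInd; split_ifs <;> norm_num

open scoped Classical in
lemma measurable_ite_le_and_le {α : Type*} [MeasurableSpace α] {a b c d : α → ℝ}
    (ha : Measurable a) (hb : Measurable b) (hc : Measurable c) (hd : Measurable d) :
    Measurable fun z => if a z ≤ b z ∧ c z ≤ d z then (1 : ℝ) else 0 :=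
  Measurable.ite ((measurableSet_le ha hb).inter (measurableSet_le hc hd))
    measurable_const measurable_const

lemma measurable_tripleInd {n : ℕ} (t : Fin n × Fin n × Fin n) :
    Measurable (tripleInd t) := by
  unfold tripleInd
  refine measurable_ite_le_and_le ?_ ?_ ?_ ?_ <;> fun_prop

lemma memLp_tripleInd {n : ℕ} (t : Fin n × Fin n × Fin n) (p : ENNReal)
    (P : Measure (Fin n → ℝ × ℝ)) [IsProbabilityMeasure P] : MemLp (tripleInd t) p P :=
  MemLp.of_bound (measurable_tripleInd t).aestronglyMeasurable 1
    (Eventually.of_forall fun z => by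
      rw [Real.norm_eq_abs, abs_of_nonneg (tripleInd_nonneg t z)]; exact tripleInd_le_one t z)

lemma spearmanT_eq_sum_tripleInd (n : ℕ) (z : Fin n → ℝ × ℝ) :
    spearmanT n z = ∑ t : Fin n × Fin n × Fin n, tripleInd t z := by
  simp only [spearmanT, rankOf, tripleInd, Fintype.sum_prod_type, Finset.natCast_card_filter]
  refine Finset.sum_congr rfl fun i _ => ?_
  rw [Finset.sum_mul_sum]
  refine Finset.sum_congr rfl fun j _ => Finset.sum_congr rfl fun k _ => ?_
  simp only [← ite_and, mul_ite, mul_one, mul_zero]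
  congr 1
  exact propext and_comm

lemma measurable_spearmanT (n : ℕ) : Measurable (spearmanT n) := by
  have : spearmanT n = fun z => ∑ t : Fin n × Fin n × Fin n, tripleInd t z :=
    funext (spearmanT_eq_sum_tripleInd n)
  rw [this]
  exact Finset.measurable_sum _ fun t _ => measurable_tripleInd t

/-- The Spearman statistic is invariant under strictly increasing coordinatewise maps. -/
lemma spearmanT_comp (n : ℕ) {f g : ℝ → ℝ} (hf : StrictMono f) (hg : StrictMono g)
    (z : Fin n → ℝ × ℝ) :
    spearmanT n (fun i => (f (z i).1, g (z i).2)) = spearmanT n z := by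
  simp only [spearmanT, rankOf, hf.le_iff_le, hg.le_iff_le]

/-- The indices of the triple, as a finite set. -/
def tripleSet {n : ℕ} (t : Fin n × Fin n × Fin n) : Finset (Fin n) := {t.1, t.2.1, t.2.2}

section Moments

variable {n : ℕ} {μ : Measure (ℝ × ℝ)} [IsProbabilityMeasure μ]

instance : IsProbabilityMeasure (iid n μ) := by unfold iid; infer_instance

lemma iIndepFun_iid_eval : iIndepFun (fun (i : Fin n) (z : Fin n → ℝ × ℝ) => z i) (iid n μ) :=
  iIndepFun_pi (μ := fun _ : Fin n => μ) (X := fun _ => id) (fun _ => aemeasurable_id)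

lemma map_eval_iid (i : Fin n) : (iid n μ).map (fun z => z i) = μ :=
  (measurePreserving_eval (fun _ : Fin n => μ) i).map_eq

lemma covariance_tripleInd_le_one (s t : Fin n × Fin n × Fin n) :
    cov[tripleInd s, tripleInd t; iid n μ] ≤ 1 := by
  rw [covariance_eq_sub (memLp_tripleInd s 2 _) (memLp_tripleInd t 2 _)]
  have h1 : (iid n μ)[tripleInd s * tripleInd t] ≤ 1 := by
    calc _ ≤ ∫ _, (1 : ℝ) ∂(iid n μ) := by
          refine integral_mono_of_nonneg (Eventually.of_forall fun z => ?_)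
            (integrable_const _) (Eventually.of_forall fun z => ?_)
          · exact mul_nonneg (tripleInd_nonneg s z) (tripleInd_nonneg t z)
          · exact mul_le_one₀ (tripleInd_le_one s z) (tripleInd_nonneg t z) (tripleInd_le_one t z)
      _ = 1 := by simp
  have h2 : 0 ≤ (iid n μ)[tripleInd s] := integral_nonneg (tripleInd_nonneg s)
  have h3 : 0 ≤ (iid n μ)[tripleInd t] := integral_nonneg (tripleInd_nonneg t)
  nlinarith [mul_nonneg h2 h3]

lemma covariance_tripleInd_of_disjoint {s t : Fin n × Fin n × Fin n}
    (h : Disjoint (tripleSet s) (tripleSet t)) :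
    cov[tripleInd s, tripleInd t; iid n μ] = 0 := by
  refine IndepFun.covariance_eq_zero ?_ (memLp_tripleInd s 2 _) (memLp_tripleInd t 2 _)
  have hI := iIndepFun_iid_eval (n := n) (μ := μ) |>.indepFun_finset _ _ h
    (fun i => measurable_pi_apply i)
  classical
  have key : ∀ s : Fin n × Fin n × Fin n, ∃ φ : (tripleSet s → ℝ × ℝ) → ℝ, Measurable φ ∧
      tripleInd s = φ ∘ (fun z (i : tripleSet s) => z i) := by
    intro s
    have m1 : s.1 ∈ tripleSet s := by simp [tripleSet]
    have m2 : s.2.1 ∈ tripleSet s := by simp [tripleSet]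
    have m3 : s.2.2 ∈ tripleSet s := by simp [tripleSet]
    refine ⟨fun w => if (w ⟨_, m2⟩).1 ≤ (w ⟨_, m1⟩).1 ∧ (w ⟨_, m3⟩).2 ≤ (w ⟨_, m1⟩).2
      then 1 else 0, ?_, ?_⟩
    · refine measurable_ite_le_and_le ?_ ?_ ?_ ?_ <;> fun_prop
    · funext z
      simp [tripleInd]
  obtain ⟨φ, hφ, hs⟩ := key s
  obtain ⟨ψ, hψ, ht⟩ := key t
  rw [hs, ht]
  exact hI.comp hφ hψ

/-- The variance of the Spearman statistic of an i.i.d. sample is of order at most `n ^ 5`. -/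
lemma variance_spearmanT_le : Var[spearmanT n; iid n μ] ≤ 9 * (n : ℝ) ^ 5 := by
  have : spearmanT n = fun z => ∑ t : Fin n × Fin n × Fin n, tripleInd t z :=
    funext (spearmanT_eq_sum_tripleInd n)
  rw [this, variance_fun_sum (fun t => memLp_tripleInd t 2 _)]
  let e : Fin n → Fin n → ℝ := fun i j => if i = j then 1 else 0
  have he : ∀ i j, 0 ≤ e i j := fun i j => by simp only [e]; split_ifs <;> norm_num
  have hb : ∀ s t : Fin n × Fin n × Fin n, cov[tripleInd s, tripleInd t; iid n μ] ≤
      (e s.1 t.1 + e s.1 t.2.1 + e s.1 t.2.2) + (e s.2.1 t.1 + e s.2.1 t.2.1 + e s.2.1 t.2.2) +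
        (e s.2.2 t.1 + e s.2.2 t.2.1 + e s.2.2 t.2.2) := by
    intro s t
    by_cases h : Disjoint (tripleSet s) (tripleSet t)
    · rw [covariance_tripleInd_of_disjoint h]
      have := he
      positivity
    · refine (covariance_tripleInd_le_one s t).trans ?_
      have h1 := he s.1 t.1
      have h2 := he s.1 t.2.1
      have h3 := he s.1 t.2.2
      have h4 := he s.2.1 t.1
      have h5 := he s.2.1 t.2.1
      have h6 := he s.2.1 t.2.2
      have h7 := he s.2.2 t.1
      have h8 := he s.2.2 t.2.1
      have h9 := he s.2.2 t.2.2
      obtain ⟨a, ha, hb⟩ := Finset.not_disjoint_iff.1 h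
      simp only [tripleSet, Finset.mem_insert, Finset.mem_singleton] at ha hb
      have hee : ∀ i, e i i = 1 := fun i => by simp [e]
      rcases ha with ha | ha | ha <;> rcases hb with hb | hb | hb <;>
      · have h10 := congrArg₂ e ha hb
        rw [hee] at h10
        linarith
  have he_sum : ∀ i, ∑ j, e i j = 1 := fun i => by simp [e]
  clear_value e
  have c1 : ∀ i, ∑ t : Fin n × Fin n × Fin n, e i t.1 = (n : ℝ) ^ 2 := fun i => by
    simp [Fintype.sum_prod_type, ← Finset.mul_sum, he_sum, sq]
  have c2 : ∀ i, ∑ t : Fin n × Fin n × Fin n, e i t.2.1 = (n : ℝ) ^ 2 := fun i => by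
    simp [Fintype.sum_prod_type, ← Finset.mul_sum, he_sum, sq]
  have c3 : ∀ i, ∑ t : Fin n × Fin n × Fin n, e i t.2.2 = (n : ℝ) ^ 2 := fun i => by
    simp [Fintype.sum_prod_type, he_sum, sq]
  calc _ ≤ _ := Finset.sum_le_sum fun s _ => Finset.sum_le_sum fun t _ => hb s t
    _ = 9 * (n : ℝ) ^ 5 := by
      simp only [Finset.sum_add_distrib, c1, c2, c3]
      simp
      ring

end Moments

instance : IsProbabilityMeasure stdGauss := by unfold stdGauss; infer_instance

instance : IsProbabilityMeasure stdGauss2 := by unfold stdGauss2; infer_instance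

instance : NullSingletonClass stdGauss := by
  unfold stdGauss; exact nullSingletonClass_gaussianReal one_ne_zero

lemma Phi_mono : Monotone Phi := fun _ _ hab =>
  ENNReal.toReal_mono (measure_ne_top _ _) (measure_mono (Set.Iic_subset_Iic.2 hab))

lemma measurable_Phi : Measurable Phi := Phi_mono.measurable

lemma Phi_nonneg (t : ℝ) : 0 ≤ Phi t := ENNReal.toReal_nonneg

lemma Phi_le_one (t : ℝ) : Phi t ≤ 1 := measureReal_le_one (μ := stdGauss) (s := Set.Iic t)

lemma Phi_sub {a b : ℝ} (hab : a ≤ b) : Phi b - Phi a = stdGauss.real (Set.Ioc a b) := by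
  have h : Set.Ioc a b = Set.Iic b \ Set.Iic a := by ext x; simp [and_comm]
  rw [h, measureReal_sdiff (Set.Iic_subset_Iic.2 hab) measurableSet_Iic]
  rfl

lemma stdGauss_map_neg : stdGauss.map (fun x => -x) = stdGauss := by
  simp [stdGauss, gaussianReal_map_neg]

lemma Phi_neg (t : ℝ) : Phi (-t) = 1 - Phi t := by
  have h : stdGauss.real (Set.Iic (-t)) = stdGauss.real (Set.Ioi t) := by
    conv_lhs => rw [← stdGauss_map_neg]
    rw [map_measureReal_apply measurable_neg measurableSet_Iic]
    have : (fun x : ℝ => -x) ⁻¹' Set.Iic (-t) = Set.Ici t := by ext x; simp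
    rw [this]
    exact (measureReal_congr Ioi_ae_eq_Ici).symm
  have h2 := probReal_compl_eq_one_sub (μ := stdGauss) (measurableSet_Iic (a := t))
  rw [Set.compl_Iic] at h2
  exact h.trans h2

lemma Phi_strictMono : StrictMono Phi := by
  intro a b hab
  have h : 0 < stdGauss.real (Set.Ioc a b) := by
    have h0 : stdGauss (Set.Ioc a b) ≠ 0 := fun h0 => by
      have := gaussianReal_absolutelyContinuous' (0 : ℝ) (one_ne_zero) h0
      simp at this
      linarith
    exact ENNReal.toReal_pos h0 (measure_ne_top _ _)
  rw [← Phi_sub hab.le] at h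
  linarith

lemma Phi_pos (t : ℝ) : 0 < Phi t := (Phi_nonneg (t - 1)).trans_lt (Phi_strictMono (by linarith))

lemma Phi_lt_one (t : ℝ) : Phi t < 1 :=
  (Phi_strictMono (show t < t + 1 by linarith)).trans_le (Phi_le_one _)

/-- A linear lower bound for the increments of `Phi` on a bounded interval. -/
lemma exists_mul_sub_le_Phi_sub :
    ∃ m : ℝ, 0 < m ∧ ∀ a b : ℝ, -2 ≤ a → a ≤ b → b ≤ 2 → m * (b - a) ≤ Phi b - Phi a := by
  refine ⟨(√(2 * π))⁻¹ * Real.exp (-2), by positivity, fun a b ha hab hb => ?_⟩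
  rw [Phi_sub hab]
  set m := (√(2 * π))⁻¹ * Real.exp (-2) with hm
  have hm0 : 0 ≤ m := by positivity
  have h : ENNReal.ofReal (m * (b - a)) ≤ stdGauss (Set.Ioc a b) := by
    rw [stdGauss, gaussianReal_apply _ one_ne_zero, ENNReal.ofReal_mul hm0, ← Real.volume_Ioc,
      ← setLIntegral_const]
    refine setLIntegral_mono (measurable_gaussianPDF _ _) fun x hx => ?_
    refine ENNReal.ofReal_le_ofReal ?_
    rw [gaussianPDFReal, hm]
    simp only [NNReal.coe_one, mul_one, sub_zero]
    gcongr
    nlinarith [hx.1, hx.2, mul_nonneg (show (0:ℝ) ≤ x + 2 by linarith [hx.1])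
      (show (0:ℝ) ≤ 2 - x by linarith [hx.2])]
  exact (ENNReal.ofReal_le_iff_le_toReal (measure_ne_top _ _)).1 h

lemma integrable_of_abs_le {α : Type*} [MeasurableSpace α] {P : Measure α}
    [IsFiniteMeasure P] {f : α → ℝ} (hf : Measurable f) (C : ℝ) (h : ∀ x, |f x| ≤ C) :
    Integrable f P :=
  Integrable.of_bound hf.aestronglyMeasurable C (Eventually.of_forall h)

/-- The centred distribution function `Phi - 1 / 2`. -/
def cPhi (t : ℝ) : ℝ := Phi t - 1 / 2

lemma measurable_cPhi : Measurable cPhi := measurable_Phi.sub_const _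

lemma cPhi_neg (t : ℝ) : cPhi (-t) = -cPhi t := by
  simp only [cPhi, Phi_neg]; ring

lemma cPhi_mono : Monotone cPhi := fun _ _ h => sub_le_sub_right (Phi_mono h) _

lemma cPhi_zero : cPhi 0 = 0 := by
  have := cPhi_neg 0
  rw [neg_zero] at this
  linarith

lemma abs_cPhi_le (t : ℝ) : |cPhi t| ≤ 1 := by
  rw [abs_le, cPhi]
  constructor <;> linarith [Phi_nonneg t, Phi_le_one t]

lemma integral_cPhi : ∫ x, cPhi x ∂stdGauss = 0 := by
  have h : ∫ x, cPhi x ∂stdGauss = ∫ x, cPhi (-x) ∂stdGauss := by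
    conv_lhs => rw [← stdGauss_map_neg]
    rw [integral_map measurable_neg.aemeasurable measurable_cPhi.aestronglyMeasurable]
  simp only [cPhi_neg, integral_neg] at h
  linarith

/-- The concordance functional `E[Φ(X) Φ(Y)]`, for `(X, Y)` distributed as `μ`. -/
def theta (μ : Measure (ℝ × ℝ)) : ℝ := ∫ p, Phi p.1 * Phi p.2 ∂μ

lemma abs_Phi_mul_Phi_le (p : ℝ × ℝ) : |Phi p.1 * Phi p.2| ≤ 1 := by
  rw [abs_of_nonneg (mul_nonneg (Phi_nonneg _) (Phi_nonneg _))]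
  exact mul_le_one₀ (Phi_le_one _) (Phi_nonneg _) (Phi_le_one _)

lemma measurable_Phi_mul_Phi : Measurable fun p : ℝ × ℝ => Phi p.1 * Phi p.2 :=
  (measurable_Phi.comp measurable_fst).mul (measurable_Phi.comp measurable_snd)

lemma theta_nonneg (μ : Measure (ℝ × ℝ)) : 0 ≤ theta μ :=
  integral_nonneg fun _ => mul_nonneg (Phi_nonneg _) (Phi_nonneg _)

section Mean

variable {n : ℕ} {μ : Measure (ℝ × ℝ)} [IsProbabilityMeasure μ]

lemma theta_le_one : theta μ ≤ 1 := by
  calc theta μ ≤ ∫ _, (1 : ℝ) ∂μ :=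
        integral_mono (integrable_of_abs_le measurable_Phi_mul_Phi 1 abs_Phi_mul_Phi_le)
          (integrable_const _) fun p => (le_abs_self _).trans (abs_Phi_mul_Phi_le p)
    _ = 1 := by simp

lemma theta_eq (h1 : μ.map Prod.fst = stdGauss) (h2 : μ.map Prod.snd = stdGauss) :
    theta μ = 1 / 4 + ∫ p, cPhi p.1 * cPhi p.2 ∂μ := by
  have m1 : Measurable fun p : ℝ × ℝ => cPhi p.1 := measurable_cPhi.comp measurable_fst
  have m2 : Measurable fun p : ℝ × ℝ => cPhi p.2 := measurable_cPhi.comp measurable_snd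
  have i1 : ∫ p, cPhi p.1 ∂μ = 0 := by
    rw [← integral_cPhi, ← h1, integral_map measurable_fst.aemeasurable
      measurable_cPhi.aestronglyMeasurable]
  have i2 : ∫ p, cPhi p.2 ∂μ = 0 := by
    rw [← integral_cPhi, ← h2, integral_map measurable_snd.aemeasurable
      measurable_cPhi.aestronglyMeasurable]
  have I1 : Integrable (fun p : ℝ × ℝ => 1 / 2 * cPhi p.1) μ :=
    (integrable_of_abs_le m1 1 fun p => abs_cPhi_le _).const_mul _
  have I2 : Integrable (fun p : ℝ × ℝ => 1 / 2 * cPhi p.2) μ :=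
    (integrable_of_abs_le m2 1 fun p => abs_cPhi_le _).const_mul _
  have I3 : Integrable (fun p : ℝ × ℝ => cPhi p.1 * cPhi p.2) μ :=
    integrable_of_abs_le (m1.mul m2) 1 fun p => by
      rw [abs_mul]
      exact mul_le_one₀ (abs_cPhi_le _) (abs_nonneg _) (abs_cPhi_le _)
  have hfun : (fun p : ℝ × ℝ => Phi p.1 * Phi p.2) =
      fun p => (1 / 4 + cPhi p.1 * cPhi p.2) + (1 / 2 * cPhi p.1 + 1 / 2 * cPhi p.2) := by
    funext p; simp only [cPhi]; ring
  rw [theta, hfun, integral_add (by exact (integrable_const _).add I3) (by exact I1.add I2),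
    integral_add (integrable_const _) I3, integral_add I1 I2, integral_const_mul,
    integral_const_mul, i1, i2]
  simp

lemma integral_tripleInd_of_ne (h1 : μ.map Prod.fst = stdGauss)
    (h2 : μ.map Prod.snd = stdGauss) {i j k : Fin n} (hij : i ≠ j) (hik : i ≠ k)
    (hjk : j ≠ k) :
    ∫ z, tripleInd (i, j, k) z ∂(iid n μ) = theta μ := by
  classical
  have hI := iIndepFun_iid_eval (n := n) (μ := μ)
  have hm : ∀ i : Fin n, Measurable fun z : Fin n → ℝ × ℝ => z i := fun i => measurable_pi_apply i
  have hlaw2 : (iid n μ).map (fun z => (z j, z k)) = μ.prod μ := by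
    rw [(indepFun_iff_map_prod_eq_prod_map_map (hm j).aemeasurable (hm k).aemeasurable).1
      (hI.indepFun hjk), map_eval_iid, map_eval_iid]
  have hlaw3 : (iid n μ).map (fun z => ((z j, z k), z i)) = (μ.prod μ).prod μ := by
    rw [(indepFun_iff_map_prod_eq_prod_map_map ((hm j).prodMk (hm k)).aemeasurable
      (hm i).aemeasurable).1 (hI.indepFun_prodMk hm j k i hij.symm hik.symm), hlaw2, map_eval_iid]
  let f : ((ℝ × ℝ) × ℝ × ℝ) × ℝ × ℝ → ℝ :=
    fun w => if w.1.1.1 ≤ w.2.1 ∧ w.1.2.2 ≤ w.2.2 then 1 else 0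
  have hf : Measurable f := by
    refine measurable_ite_le_and_le ?_ ?_ ?_ ?_ <;> fun_prop
  have hf1 : ∀ w, |f w| ≤ 1 := fun w => by
    simp only [f]; split_ifs <;> simp
  have hfz : (fun z => tripleInd (i, j, k) z) = fun z => f ((z j, z k), z i) := by
    funext z
    simp [tripleInd, f]
  rw [hfz, ← integral_map (φ := fun z : Fin n → ℝ × ℝ => ((z j, z k), z i))
    (((hm j).prodMk (hm k)).prodMk (hm i)).aemeasurable hf.aestronglyMeasurable, hlaw3,
    integral_prod_symm _ (integrable_of_abs_le hf 1 hf1), theta]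
  congr 1
  funext p
  have hfun : (fun q : (ℝ × ℝ) × ℝ × ℝ => f (q, p)) = fun q =>
      (Set.indicator {r : ℝ × ℝ | r.1 ≤ p.1} 1 q.1) *
        (Set.indicator {r : ℝ × ℝ | r.2 ≤ p.2} 1 q.2) := by
    funext q
    simp only [f, Set.indicator_apply, Set.mem_ofPred_eq, Pi.one_apply]
    split_ifs <;> simp_all
  have s1 : MeasurableSet {r : ℝ × ℝ | r.1 ≤ p.1} := measurableSet_le measurable_fst (by fun_prop)
  have s2 : MeasurableSet {r : ℝ × ℝ | r.2 ≤ p.2} := measurableSet_le measurable_snd (by fun_prop)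
  rw [hfun, integral_prod_mul, integral_indicator_one s1, integral_indicator_one s2]
  congr 1
  · rw [Phi, ← h1, Measure.map_apply measurable_fst measurableSet_Iic]; rfl
  · rw [Phi, ← h2, Measure.map_apply measurable_snd measurableSet_Iic]; rfl

/-- The mean of the Spearman statistic of an i.i.d. sample with standard normal marginals. -/
lemma abs_integral_spearmanT_sub_le (h1 : μ.map Prod.fst = stdGauss)
    (h2 : μ.map Prod.snd = stdGauss) :
    |∫ z, spearmanT n z ∂(iid n μ) - (n : ℝ) ^ 3 * theta μ| ≤ 3 * (n : ℝ) ^ 2 := by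
  let e : Fin n → Fin n → ℝ := fun i j => if i = j then 1 else 0
  have he : ∀ i j, 0 ≤ e i j := fun i j => by simp only [e]; split_ifs <;> norm_num
  have hee : ∀ i, e i i = 1 := fun i => by simp [e]
  have he_sum : ∀ i, ∑ j, e i j = 1 := fun i => by simp [e]
  have hb : ∀ t : Fin n × Fin n × Fin n, |∫ z, tripleInd t z ∂(iid n μ) - theta μ| ≤
      e t.1 t.2.1 + e t.1 t.2.2 + e t.2.1 t.2.2 := by
    rintro ⟨i, j, k⟩
    by_cases h : i ≠ j ∧ i ≠ k ∧ j ≠ k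
    · rw [integral_tripleInd_of_ne h1 h2 h.1 h.2.1 h.2.2, sub_self, abs_zero]
      have := he
      positivity
    · have hA : 0 ≤ ∫ z, tripleInd (i, j, k) z ∂(iid n μ) :=
        integral_nonneg (tripleInd_nonneg _)
      have hB : ∫ z, tripleInd (i, j, k) z ∂(iid n μ) ≤ 1 := by
        calc _ ≤ ∫ _, (1 : ℝ) ∂(iid n μ) :=
              integral_mono ((memLp_tripleInd _ 1 _).integrable le_rfl) (integrable_const _)
                (tripleInd_le_one _)
          _ = 1 := by simp
      have hC : |∫ z, tripleInd (i, j, k) z ∂(iid n μ) - theta μ| ≤ 1 := by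
        rw [abs_le]
        constructor <;> linarith [theta_nonneg μ, theta_le_one (μ := μ)]
      refine hC.trans ?_
      have e1 := he i j
      have e2 := he i k
      have e3 := he j k
      by_cases hij : i = j
      · have := hee j; subst hij; dsimp only; linarith
      by_cases hik : i = k
      · have := hee k; subst hik; dsimp only; linarith
      by_cases hjk : j = k
      · have := hee k; subst hjk; dsimp only; linarith
      exact absurd ⟨hij, hik, hjk⟩ h
  clear_value e
  have hsum : ∫ z, spearmanT n z ∂(iid n μ) - (n : ℝ) ^ 3 * theta μ =
      ∑ t : Fin n × Fin n × Fin n, (∫ z, tripleInd t z ∂(iid n μ) - theta μ) := by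
    simp only [spearmanT_eq_sum_tripleInd]
    rw [integral_finsetSum _ fun t _ => (memLp_tripleInd t 1 _).integrable le_rfl,
      Finset.sum_sub_distrib]
    congr 1
    simp only [Finset.sum_const, Finset.card_univ, Fintype.card_prod, Fintype.card_fin,
      nsmul_eq_mul]
    push_cast
    ring
  rw [hsum]
  refine (Finset.abs_sum_le_sum_abs _ _).trans ((Finset.sum_le_sum fun t _ => hb t).trans ?_)
  simp only [Finset.sum_add_distrib, Fintype.sum_prod_type, he_sum, Finset.sum_const,
    Finset.card_univ, Fintype.card_fin, nsmul_eq_mul, ← Finset.mul_sum, mul_one]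
  apply le_of_eq
  ring

end Mean

lemma measurable_biNormal_map (ρ : ℝ) :
    Measurable fun z : ℝ × ℝ => (z.1, ρ * z.1 + √(1 - ρ ^ 2) * z.2) := by
  fun_prop

instance (ρ : ℝ) : IsProbabilityMeasure (biNormal ρ) :=
  Measure.isProbabilityMeasure_map (measurable_biNormal_map ρ).aemeasurable

lemma biNormal_map_fst (ρ : ℝ) : (biNormal ρ).map Prod.fst = stdGauss := by
  rw [biNormal, Measure.map_map measurable_fst (measurable_biNormal_map ρ)]
  have : (Prod.fst ∘ fun z : ℝ × ℝ => (z.1, ρ * z.1 + √(1 - ρ ^ 2) * z.2)) = Prod.fst := rfl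
  rw [this, stdGauss2, Measure.map_fst_prod]
  simp

lemma biNormal_map_snd {ρ : ℝ} (h0 : 0 ≤ ρ) (h1 : ρ ≤ 1) :
    (biNormal ρ).map Prod.snd = stdGauss := by
  rw [biNormal, Measure.map_map measurable_snd (measurable_biNormal_map ρ)]
  have hI : IndepFun (fun z : ℝ × ℝ => ρ * z.1) (fun z : ℝ × ℝ => √(1 - ρ ^ 2) * z.2) stdGauss2 :=
    indepFun_prod (X := fun x : ℝ => ρ * x) (Y := fun y : ℝ => √(1 - ρ ^ 2) * y)
      (by fun_prop) (by fun_prop)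
  have hX : stdGauss2.map (fun z : ℝ × ℝ => ρ * z.1) = gaussianReal 0 (NNReal.mk (ρ ^ 2) (sq_nonneg _)) := by
    have : (fun z : ℝ × ℝ => ρ * z.1) = (fun x => ρ * x) ∘ Prod.fst := rfl
    rw [this, ← Measure.map_map (by fun_prop) measurable_fst, stdGauss2, Measure.map_fst_prod]
    simp [stdGauss, gaussianReal_map_const_mul]
  have hY : stdGauss2.map (fun z : ℝ × ℝ => √(1 - ρ ^ 2) * z.2) =
      gaussianReal 0 (NNReal.mk (√(1 - ρ ^ 2) ^ 2) (sq_nonneg _)) := by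
    have : (fun z : ℝ × ℝ => √(1 - ρ ^ 2) * z.2) = (fun x => √(1 - ρ ^ 2) * x) ∘ Prod.snd := rfl
    rw [this, ← Measure.map_map (by fun_prop) measurable_snd, stdGauss2, Measure.map_snd_prod]
    simp only [stdGauss, measure_univ, one_smul, gaussianReal_map_const_mul, mul_zero, mul_one]
  have h := gaussianReal_add_gaussianReal_of_indepFun hI hX hY
  have hv : (NNReal.mk (ρ ^ 2) (sq_nonneg _) + NNReal.mk (√(1 - ρ ^ 2) ^ 2) (sq_nonneg _)) = 1 := by
    apply NNReal.eq
    rw [NNReal.coe_add]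
    change ρ ^ 2 + √(1 - ρ ^ 2) ^ 2 = 1
    rw [Real.sq_sqrt (by nlinarith)]
    ring
  rw [hv, add_zero] at h
  exact h

lemma measurePreserving_neg_snd :
    MeasurePreserving (fun z : ℝ × ℝ => (z.1, -z.2)) stdGauss2 stdGauss2 :=
  (MeasurePreserving.id stdGauss).prod ⟨measurable_neg, stdGauss_map_neg⟩

lemma theta_biNormal_eq {ρ : ℝ} (h0 : 0 ≤ ρ) (h1 : ρ ≤ 1) :
    theta (biNormal ρ) = 1 / 4 + 1 / 2 * ∫ z : ℝ × ℝ, cPhi z.1 *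
      (cPhi (√(1 - ρ ^ 2) * z.2 + ρ * z.1) - cPhi (√(1 - ρ ^ 2) * z.2 - ρ * z.1)) ∂stdGauss2 := by
  set s := √(1 - ρ ^ 2) with hs
  rw [theta_eq (biNormal_map_fst ρ) (biNormal_map_snd h0 h1)]
  have hm : ∀ a : ℝ, Measurable fun z : ℝ × ℝ => cPhi z.1 * cPhi (s * z.2 + a * z.1) := fun a =>
    (measurable_cPhi.comp measurable_fst).mul (measurable_cPhi.comp (by fun_prop))
  have h_int : ∀ a : ℝ, Integrable (fun z : ℝ × ℝ => cPhi z.1 * cPhi (s * z.2 + a * z.1)) stdGauss2 :=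
    fun a => integrable_of_abs_le (hm a) 1 fun z => by
      rw [abs_mul]
      exact mul_le_one₀ (abs_cPhi_le _) (abs_nonneg _) (abs_cPhi_le _)
  have hA : ∫ p, cPhi p.1 * cPhi p.2 ∂(biNormal ρ) =
      ∫ z : ℝ × ℝ, cPhi z.1 * cPhi (s * z.2 + ρ * z.1) ∂stdGauss2 := by
    have hm' : Measurable fun p : ℝ × ℝ => cPhi p.1 * cPhi p.2 :=
      (measurable_cPhi.comp measurable_fst).mul (measurable_cPhi.comp measurable_snd)
    rw [biNormal, integral_map (measurable_biNormal_map ρ).aemeasurable hm'.aestronglyMeasurable]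
    simp only [add_comm, hs]
  have hB : ∫ z : ℝ × ℝ, cPhi z.1 * cPhi (s * z.2 + ρ * z.1) ∂stdGauss2 =
      -∫ z : ℝ × ℝ, cPhi z.1 * cPhi (s * z.2 + -ρ * z.1) ∂stdGauss2 := by
    conv_lhs => rw [← measurePreserving_neg_snd.map_eq]
    rw [integral_map measurePreserving_neg_snd.measurable.aemeasurable
      (hm ρ).aestronglyMeasurable, ← integral_neg]
    congr 1
    funext z
    have : s * -z.2 + ρ * z.1 = -(s * z.2 + -ρ * z.1) := by ring
    simp only [this, cPhi_neg]
    ring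
  have hC : ∫ z : ℝ × ℝ, cPhi z.1 * (cPhi (s * z.2 + ρ * z.1) - cPhi (s * z.2 - ρ * z.1)) ∂stdGauss2
      = ∫ z : ℝ × ℝ, cPhi z.1 * cPhi (s * z.2 + ρ * z.1) ∂stdGauss2 -
        ∫ z : ℝ × ℝ, cPhi z.1 * cPhi (s * z.2 + -ρ * z.1) ∂stdGauss2 := by
    rw [← integral_sub (h_int ρ) (h_int (-ρ))]
    congr 1
    funext z
    rw [mul_sub, neg_mul, ← sub_eq_add_neg]
  rw [hA, hC]
  linarith

lemma theta_biNormal_zero : theta (biNormal 0) = 1 / 4 := by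
  rw [theta_biNormal_eq le_rfl zero_le_one]
  simp

/-- The concordance functional of the bivariate normal exceeds its null value `1 / 4` by at
least a multiple of the correlation. -/
lemma exists_le_theta_biNormal :
    ∃ c : ℝ, 0 < c ∧ ∀ ρ : ℝ, 0 ≤ ρ → ρ ≤ 1 → 1 / 4 + c * ρ ≤ theta (biNormal ρ) := by
  obtain ⟨m, hm, hmb⟩ := exists_mul_sub_le_Phi_sub
  set S : Set (ℝ × ℝ) := Set.Icc (1 / 2) 1 ×ˢ Set.Icc (-1) 1 with hS
  have hSm : MeasurableSet S := measurableSet_Icc.prod measurableSet_Icc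
  have hpos : ∀ a b : ℝ, a < b → stdGauss (Set.Icc a b) ≠ 0 := fun a b hab h0 => by
    have := gaussianReal_absolutelyContinuous' (0 : ℝ) (one_ne_zero) h0
    simp at this
    linarith
  have hS0 : 0 < stdGauss2.real S := by
    refine ENNReal.toReal_pos ?_ (measure_ne_top _ _)
    rw [stdGauss2, hS, Measure.prod_prod]
    exact mul_ne_zero (hpos _ _ (by norm_num)) (hpos _ _ (by norm_num))
  refine ⟨1 / 4 * m ^ 2 * stdGauss2.real S, by positivity, fun ρ h0 h1 => ?_⟩
  rw [theta_biNormal_eq h0 h1]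
  set s := √(1 - ρ ^ 2) with hs
  have hs0 : 0 ≤ s := Real.sqrt_nonneg _
  have hs1 : s ≤ 1 := Real.sqrt_le_one.2 (by nlinarith)
  have hle : ∀ z : ℝ × ℝ, S.indicator (fun _ => 1 / 2 * m ^ 2 * ρ) z ≤
      cPhi z.1 * (cPhi (s * z.2 + ρ * z.1) - cPhi (s * z.2 - ρ * z.1)) := by
    intro z
    by_cases hz : z ∈ S
    · rw [Set.indicator_of_mem hz]
      obtain ⟨⟨hx0, hx1⟩, hy0, hy1⟩ := hz
      have hρx : 0 ≤ ρ * z.1 := mul_nonneg h0 (by linarith)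
      have hρx1 : ρ * z.1 ≤ 1 := mul_le_one₀ h1 (by linarith) hx1
      have hsy : |s * z.2| ≤ 1 := by
        rw [abs_mul, abs_of_nonneg hs0]
        exact mul_le_one₀ hs1 (abs_nonneg _) (abs_le.2 ⟨hy0, hy1⟩)
      obtain ⟨hsy0, hsy1⟩ := abs_le.1 hsy
      have hA : m * (1 / 2) ≤ cPhi z.1 := by
        have h := hmb 0 z.1 (by norm_num) (by linarith) (by linarith)
        have h' := cPhi_zero
        simp only [cPhi] at h' ⊢
        nlinarith
      have hB : m * ρ ≤ cPhi (s * z.2 + ρ * z.1) - cPhi (s * z.2 - ρ * z.1) := by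
        have h := hmb (s * z.2 - ρ * z.1) (s * z.2 + ρ * z.1) (by linarith) (by linarith)
          (by linarith)
        simp only [cPhi]
        nlinarith [mul_nonneg (mul_nonneg hm.le h0) (show 0 ≤ 2 * z.1 - 1 by linarith)]
      calc 1 / 2 * m ^ 2 * ρ = (m * (1 / 2)) * (m * ρ) := by ring
        _ ≤ _ := mul_le_mul hA hB (by positivity) ((by positivity : 0 ≤ m * (1 / 2)).trans hA)
    · rw [Set.indicator_of_notMem hz]
      rcases le_total 0 z.1 with hx | hx
      · refine mul_nonneg (cPhi_zero ▸ cPhi_mono hx) (sub_nonneg.2 (cPhi_mono ?_))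
        linarith [mul_nonneg h0 hx]
      · refine mul_nonneg_of_nonpos_of_nonpos (cPhi_zero ▸ cPhi_mono hx)
          (sub_nonpos.2 (cPhi_mono ?_))
        linarith [mul_nonpos_of_nonneg_of_nonpos h0 hx]
  have hmeas : Measurable fun z : ℝ × ℝ =>
      cPhi z.1 * (cPhi (s * z.2 + ρ * z.1) - cPhi (s * z.2 - ρ * z.1)) :=
    (measurable_cPhi.comp measurable_fst).mul
      ((measurable_cPhi.comp (by fun_prop)).sub (measurable_cPhi.comp (by fun_prop)))
  have h_int := integral_mono ((integrable_const (1 / 2 * m ^ 2 * ρ)).indicator hSm)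
    (integrable_of_abs_le (P := stdGauss2) hmeas 2 fun z => by
      rw [abs_mul]
      have h1 := abs_cPhi_le z.1
      have h2 := abs_sub (cPhi (s * z.2 + ρ * z.1)) (cPhi (s * z.2 - ρ * z.1))
      have h3 := abs_cPhi_le (s * z.2 + ρ * z.1)
      have h4 := abs_cPhi_le (s * z.2 - ρ * z.1)
      nlinarith [abs_nonneg (cPhi z.1),
        abs_nonneg (cPhi (s * z.2 + ρ * z.1) - cPhi (s * z.2 - ρ * z.1))]) hle
  rw [integral_indicator_const _ hSm, smul_eq_mul] at h_int
  nlinarith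

section Mixture

variable {ε ρ : ℝ}

lemma ofReal_one_sub_add_ofReal (h0 : 0 ≤ ε) (h1 : ε ≤ 1) :
    ENNReal.ofReal (1 - ε) + ENNReal.ofReal ε = 1 := by
  rw [← ENNReal.ofReal_add (by linarith) h0]
  simp

lemma isProbabilityMeasure_mixture (h0 : 0 ≤ ε) (h1 : ε ≤ 1) :
    IsProbabilityMeasure (mixture ε ρ) :=
  ⟨by simp [mixture, ofReal_one_sub_add_ofReal h0 h1]⟩

lemma mixture_map_fst (h0 : 0 ≤ ε) (h1 : ε ≤ 1) :
    (mixture ε ρ).map Prod.fst = stdGauss := by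
  rw [mixture, Measure.map_add _ _ measurable_fst, Measure.map_smul, Measure.map_smul,
    biNormal_map_fst, biNormal_map_fst, ← add_smul, ofReal_one_sub_add_ofReal h0 h1, one_smul]

lemma mixture_map_snd (h0 : 0 ≤ ε) (h1 : ε ≤ 1) (hρ0 : 0 ≤ ρ) (hρ1 : ρ ≤ 1) :
    (mixture ε ρ).map Prod.snd = stdGauss := by
  rw [mixture, Measure.map_add _ _ measurable_snd, Measure.map_smul, Measure.map_smul,
    biNormal_map_snd le_rfl zero_le_one, biNormal_map_snd hρ0 hρ1, ← add_smul,
    ofReal_one_sub_add_ofReal h0 h1, one_smul]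

lemma theta_mixture (h0 : 0 ≤ ε) (h1 : ε ≤ 1) :
    theta (mixture ε ρ) = (1 - ε) * (1 / 4) + ε * theta (biNormal ρ) := by
  have h_int : ∀ r : ℝ, Integrable (fun p : ℝ × ℝ => Phi p.1 * Phi p.2) (biNormal r) := fun r =>
    integrable_of_abs_le measurable_Phi_mul_Phi 1 abs_Phi_mul_Phi_le
  have hz := theta_biNormal_zero
  rw [theta] at hz
  rw [theta, theta, mixture, integral_add_measure ((h_int 0).smul_measure ENNReal.ofReal_ne_top)
    ((h_int ρ).smul_measure ENNReal.ofReal_ne_top), integral_smul_measure, integral_smul_measure,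
    hz, ENNReal.toReal_ofReal (by linarith), ENNReal.toReal_ofReal h0, smul_eq_mul, smul_eq_mul]

end Mixture

lemma strictMono_invFun_comp_Phi {F : ℝ → ℝ} (hmono : StrictMono F) (hcont : Continuous F)
    (hbot : Tendsto F atBot (𝓝 0)) (htop : Tendsto F atTop (𝓝 1)) :
    StrictMono fun t => Function.invFun F (Phi t) := by
  have hF : ∀ t, F (Function.invFun F (Phi t)) = Phi t := fun t => by
    refine Function.invFun_eq (mem_range_of_exists_le_of_exists_ge hcont ?_ ?_)
    · obtain ⟨a, ha⟩ := (hbot.eventually (gt_mem_nhds (Phi_pos t))).exists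
      exact ⟨a, ha.le⟩
    · obtain ⟨b, hb⟩ := (htop.eventually (lt_mem_nhds (Phi_lt_one t))).exists
      exact ⟨b, hb.le⟩
  intro a b hab
  rw [← hmono.lt_iff_lt, hF, hF]
  exact Phi_strictMono hab

lemma map_obsMap_spearmanT_ge {F G : ℝ → ℝ}
    (hF : StrictMono fun t => Function.invFun F (Phi t))
    (hG : StrictMono fun t => Function.invFun G (Phi t))
    (n : ℕ) (P : Measure (Fin n → ℝ × ℝ)) (c : ℝ) :
    (P.map (obsMap F G n)) {x | c ≤ spearmanT n x} = P {z | c ≤ spearmanT n z} := by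
  have hm : Measurable (obsMap F G n) := measurable_pi_lambda _ fun i =>
    (hF.monotone.measurable.comp (measurable_pi_apply i).fst).prodMk
      (hG.monotone.measurable.comp (measurable_pi_apply i).snd)
  rw [Measure.map_apply hm (measurableSet_le measurable_const (measurable_spearmanT n))]
  congr 1
  ext z
  change c ≤ spearmanT n (obsMap F G n z) ↔ c ≤ spearmanT n z
  rw [← spearmanT_comp n hF hG z]
  rfl

section Chebyshev

variable {n : ℕ} {μ : Measure (ℝ × ℝ)} [IsProbabilityMeasure μ]

lemma measureReal_abs_spearmanT_sub_ge_le (hn : 0 < n) {L : ℝ} (hL : 0 < L) :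
    (iid n μ).real {z | (n : ℝ) ^ ((5 : ℝ) / 2) * L ≤
      |spearmanT n z - ∫ z, spearmanT n z ∂(iid n μ)|} ≤ 9 / L ^ 2 := by
  have hn' : (0 : ℝ) < n := Nat.cast_pos.2 hn
  have hr : 0 < (n : ℝ) ^ ((5 : ℝ) / 2) * L := mul_pos (Real.rpow_pos_of_pos hn' _) hL
  have hLp : MemLp (spearmanT n) 2 (iid n μ) := by
    have : spearmanT n = fun z => ∑ t : Fin n × Fin n × Fin n, tripleInd t z :=
      funext (spearmanT_eq_sum_tripleInd n)
    rw [this]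
    exact memLp_finsetSum _ fun t _ => memLp_tripleInd t 2 _
  have hsq : ((n : ℝ) ^ ((5 : ℝ) / 2)) ^ 2 = (n : ℝ) ^ 5 := by
    rw [← Real.rpow_natCast, ← Real.rpow_mul hn'.le, ← Real.rpow_natCast]
    norm_num
  refine (ENNReal.toReal_le_of_le_ofReal (by positivity [variance_nonneg (spearmanT n) (iid n μ)])
    (meas_ge_le_variance_div_sq hLp hr)).trans ?_
  rw [mul_pow, hsq, div_le_div_iff₀ (by positivity) (by positivity)]
  nlinarith [mul_le_mul_of_nonneg_right (variance_spearmanT_le (n := n) (μ := μ)) (sq_nonneg L)]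

lemma measureReal_spearmanT_ge_le (hn : 0 < n) {L c : ℝ} (hL : 0 < L)
    (h : ∫ z, spearmanT n z ∂(iid n μ) + (n : ℝ) ^ ((5 : ℝ) / 2) * L ≤ c) :
    (iid n μ).real {z | c ≤ spearmanT n z} ≤ 9 / L ^ 2 := by
  refine (measureReal_mono fun z hz => ?_).trans (measureReal_abs_spearmanT_sub_ge_le hn hL)
  have hz' : c ≤ spearmanT n z := hz
  change (n : ℝ) ^ ((5 : ℝ) / 2) * L ≤ |spearmanT n z - ∫ z, spearmanT n z ∂(iid n μ)|
  exact le_trans (by linarith) (le_abs_self _)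

lemma one_sub_measureReal_spearmanT_ge_le (hn : 0 < n) {L c : ℝ} (hL : 0 < L)
    (h : c + (n : ℝ) ^ ((5 : ℝ) / 2) * L ≤ ∫ z, spearmanT n z ∂(iid n μ)) :
    1 - (iid n μ).real {z | c ≤ spearmanT n z} ≤ 9 / L ^ 2 := by
  rw [← probReal_compl_eq_one_sub (measurableSet_le measurable_const (measurable_spearmanT n))]
  refine (measureReal_mono fun z hz => ?_).trans (measureReal_abs_spearmanT_sub_ge_le hn hL)
  have hz' : spearmanT n z < c := not_le.1 hz
  change (n : ℝ) ^ ((5 : ℝ) / 2) * L ≤ |spearmanT n z - ∫ z, spearmanT n z ∂(iid n μ)|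
  exact le_trans (by linarith) (neg_le_abs _)

end Chebyshev

lemma sq_le_rpow_five_halves {n : ℕ} (hn : 1 ≤ n) : (n : ℝ) ^ 2 ≤ (n : ℝ) ^ ((5 : ℝ) / 2) := by
  rw [← Real.rpow_natCast]
  exact Real.rpow_le_rpow_of_exponent_le (Nat.one_le_cast.2 hn) (by norm_num)

/-- in the dense regime with `γ < 1/2 - β`, in the Gaussian mixture copula
model with strictly increasing continuous marginal distribution functions `F, G`, the
covariance rank (Spearman) test rejecting when `Tₙ ≥ n(n+1)²/4 + n^{5/2} log n` is
asymptotically powerful: its type I error probability (computed under the null, where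
the `Xᵢ`'s and `Yᵢ`'s are all mutually independent with continuous marginals, i.e. the
latent correlation is absent) and its type II error probability both tend to 0. -/
theorem spearman_dense_powerful (β γ : ℝ) (hβ0 : 0 < β) (hγ0 : 0 < γ)
    (hdense : γ < 1 / 2 - β)
    (ε ρ : ℕ → ℝ) (hε : ∀ n : ℕ, ε n = (n : ℝ) ^ (-β)) (hρ : ∀ n : ℕ, ρ n = (n : ℝ) ^ (-γ))
    (F G : ℝ → ℝ)
    (hF_mono : StrictMono F) (hF_cont : Continuous F)
    (hF_bot : Tendsto F atBot (𝓝 0)) (hF_top : Tendsto F atTop (𝓝 1))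
    (hG_mono : StrictMono G) (hG_cont : Continuous G)
    (hG_bot : Tendsto G atBot (𝓝 0)) (hG_top : Tendsto G atTop (𝓝 1)) :
    Tendsto (fun n =>
      (((iid n (biNormal 0)).map (obsMap F G n))
          {x : Fin n → ℝ × ℝ |
            (n : ℝ) * (n + 1) ^ 2 / 4 + (n : ℝ) ^ ((5 : ℝ) / 2) * Real.log n
              ≤ spearmanT n x}).toReal
        + (1 - (((iid n (mixture (ε n) (ρ n))).map (obsMap F G n))
          {x : Fin n → ℝ × ℝ |
            (n : ℝ) * (n + 1) ^ 2 / 4 + (n : ℝ) ^ ((5 : ℝ) / 2) * Real.log n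
              ≤ spearmanT n x}).toReal))
      atTop (𝓝 0) := by
  have hFi := strictMono_invFun_comp_Phi hF_mono hF_cont hF_bot hF_top
  have hGi := strictMono_invFun_comp_Phi hG_mono hG_cont hG_bot hG_top
  simp only [map_obsMap_spearmanT_ge hFi hGi]
  obtain ⟨c, hc, hθ⟩ := exists_le_theta_biNormal
  have hδ : 0 < 1 / 2 - β - γ := by linarith
  have hlog : Tendsto (fun n : ℕ => Real.log n) atTop atTop :=
    Real.tendsto_log_atTop.comp tendsto_natCast_atTop_atTop
  have hlim : Tendsto (fun n : ℕ => 45 / Real.log n ^ 2) atTop (𝓝 0) :=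
    tendsto_const_nhds.div_atTop ((tendsto_pow_atTop two_ne_zero).comp hlog)
  have hpow : ∀ᶠ n : ℕ in atTop, 3 * Real.log n ≤ c * (n : ℝ) ^ (1 / 2 - β - γ) := by
    have h := ((isLittleO_log_rpow_atTop hδ).comp_tendsto
      tendsto_natCast_atTop_atTop).bound (show 0 < c / 3 by positivity)
    filter_upwards [h] with n hn
    simp only [Function.comp_apply, Real.norm_eq_abs] at hn
    rw [abs_of_nonneg (Real.rpow_nonneg (Nat.cast_nonneg n) _)] at hn
    linarith [le_abs_self (Real.log n)]
  refine squeeze_zero' (Eventually.of_forall fun n => ?_) ?_ hlim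
  · by_cases hε1 : ε n ≤ 1
    · have hε0 : 0 ≤ ε n := by rw [hε]; exact Real.rpow_nonneg (Nat.cast_nonneg n) _
      have := isProbabilityMeasure_mixture (ρ := ρ n) hε0 hε1
      exact add_nonneg ENNReal.toReal_nonneg (sub_nonneg.2 measureReal_le_one)
    · exfalso
      apply hε1
      rw [hε]
      rcases Nat.eq_zero_or_pos n with rfl | hn
      · simp [hβ0.ne']
      · exact Real.rpow_le_one_of_one_le_of_nonpos (Nat.one_le_cast.2 hn) (by linarith)
  filter_upwards [hpow, hlog.eventually_ge_atTop 6, eventually_ge_atTop 1] with n hn1 hn2 hn3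
  have hn : (1 : ℝ) ≤ n := Nat.one_le_cast.2 hn3
  have hn0 : (0 : ℝ) < n := by linarith
  have hε0 : 0 ≤ ε n := by rw [hε]; exact Real.rpow_nonneg hn0.le _
  have hε1 : ε n ≤ 1 := by
    rw [hε]; exact Real.rpow_le_one_of_one_le_of_nonpos hn (by linarith)
  have hρ0 : 0 ≤ ρ n := by rw [hρ]; exact Real.rpow_nonneg hn0.le _
  have hρ1 : ρ n ≤ 1 := by
    rw [hρ]; exact Real.rpow_le_one_of_one_le_of_nonpos hn (by linarith)
  have := isProbabilityMeasure_mixture (ρ := ρ n) hε0 hε1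
  have hN := sq_le_rpow_five_halves hn3
  have hE0 := abs_le.1 (abs_integral_spearmanT_sub_le (n := n) (biNormal_map_fst 0)
    (biNormal_map_snd le_rfl zero_le_one))
  have hE1 := abs_le.1 (abs_integral_spearmanT_sub_le (n := n)
    (mixture_map_fst (ρ := ρ n) hε0 hε1) (mixture_map_snd hε0 hε1 hρ0 hρ1))
  rw [theta_biNormal_zero] at hE0
  set N : ℝ := (n : ℝ) ^ ((5 : ℝ) / 2) with hNdef
  set l : ℝ := Real.log n with hl
  have hN0 : 0 < N := Real.rpow_pos_of_pos hn0 _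
  have hI := measureReal_spearmanT_ge_le (μ := biNormal 0) (L := l / 2)
    (c := (n : ℝ) * (n + 1) ^ 2 / 4 + N * l) hn3 (by linarith) (by
      nlinarith [hE0.2, mul_nonneg hN0.le (show 0 ≤ l - 6 by linarith), sq_nonneg (n : ℝ)])
  have hsignal : (n : ℝ) ^ 3 * (ε n * ρ n) = N * (n : ℝ) ^ (1 / 2 - β - γ) := by
    rw [hε, hρ, ← Real.rpow_natCast, ← Real.rpow_add hn0, ← Real.rpow_add hn0,
      hNdef, ← Real.rpow_add hn0]
    congr 1
    push_cast
    ring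
  have hθ' : 1 / 4 + c * (ε n * ρ n) ≤ theta (mixture (ε n) (ρ n)) := by
    rw [theta_mixture hε0 hε1]
    nlinarith [mul_le_mul_of_nonneg_left (hθ (ρ n) hρ0 hρ1) hε0]
  have hII := one_sub_measureReal_spearmanT_ge_le (μ := mixture (ε n) (ρ n)) (L := l)
    (c := (n : ℝ) * (n + 1) ^ 2 / 4 + N * l) hn3 (by linarith) (by
      have h1 := mul_le_mul_of_nonneg_left hθ' (pow_nonneg hn0.le 3)
      have h2 := mul_le_mul_of_nonneg_left hn1 hN0.le
      have h3 : (n : ℝ) ^ 3 * (1 / 4 + c * (ε n * ρ n)) =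
          (n : ℝ) ^ 3 / 4 + N * (c * (n : ℝ) ^ (1 / 2 - β - γ)) := by
        rw [mul_left_comm N, ← hsignal]; ring
      have h4 : 6 * N ≤ N * l := by nlinarith
      have h5 : (n : ℝ) * (n + 1) ^ 2 / 4 ≤ (n : ℝ) ^ 3 / 4 + (n : ℝ) ^ 2 := by nlinarith
      linarith [hE1.1])
  have hfin : 9 / (l / 2) ^ 2 + 9 / l ^ 2 = 45 / l ^ 2 := by
    have : l ≠ 0 := by linarith
    field_simp
    norm_num
  rw [← hfin]
  exact add_le_add hI hII
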